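/- Let L be a finite-dimensional Lie algebra of nilpotency class two over a field k with dim(L/Z(L)) = d ≥ 3 and dim L² = ½d(d−1) − 1 or dim L² = ½d(d−1) − 2. Then L is capable, i.e., there exists a Lie algebra E over k with E/Z(E) ≅ L. -/

import Mathlib

open Module

universe u v

variable (k : Type u) [Field k]

/-- The derived subalgebra `L² = [L,L]` of a Lie algebra, as a `k`-submodule. -/
abbrev lieSq (L : Type v) [LieRing L] [LieAlgebra k L] : Submodule k L :=
  (LieModule.lowerCentralSeries k L L 1).toSubmodule

/-- The center `Z(L)` as a `k`-submodule. -/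
abbrev lieCtr (L : Type v) [LieRing L] [LieAlgebra k L] : Submodule k L :=
  (LieAlgebra.center k L).toSubmodule

/-- A witness to the capability of the Lie algebra `L`: a Lie algebra `E`
together with an isomorphism `E/Z(E) ≅ L`. -/
structure CapableWitness (L : Type v) [LieRing L] [LieAlgebra k L] : Type (max u (v + 1)) where
  E : Type v
  [instLieRing : LieRing E]
  [instLieAlgebra : LieAlgebra k E]
  equiv : (E ⧸ LieAlgebra.center k E) ≃ₗ⁅k⁆ L

theorem card_subtype_fst_lt_snd (d : ℕ) :
    Fintype.card {p : Fin d × Fin d // p.1 < p.2} = d * (d - 1) / 2 := by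
  rw [← Finset.sum_range_id_mul_two, Nat.mul_div_cancel _ two_pos, Fintype.card_subtype,
    Finset.card_filter, Fintype.sum_prod_type_right]
  simp only [← Finset.card_filter]
  rw [← Fin.sum_univ_eq_sum_range (fun i => i)]
  refine Finset.sum_congr rfl fun i _ => ?_
  rw [← Fin.card_Iio]
  congr 1
  ext; simp

section Core
variable {k}

/-- Alternating `d × d` arrays. -/
def altTwo (k : Type u) [Field k] (d : ℕ) : Submodule k (Fin d → Fin d → k) where
  carrier := {s | (∀ i, s i i = 0) ∧ ∀ i j, s i j = -s j i}
  add_mem' := by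
    rintro s t ⟨h1, h2⟩ ⟨h3, h4⟩
    refine ⟨fun i => by simp [h1, h3], fun i j => ?_⟩
    simp only [Pi.add_apply]
    rw [h2 i j, h4 i j]; ring
  zero_mem' := by simp
  smul_mem' := by
    rintro c s ⟨h1, h2⟩
    refine ⟨fun i => by simp [h1], fun i j => ?_⟩
    simp only [Pi.smul_apply, smul_eq_mul]
    rw [h2 i j]; ring

/-- Alternating `d × d × d` arrays. -/
def altThree (k : Type u) [Field k] (d : ℕ) : Submodule k (Fin d → Fin d → Fin d → k) where
  carrier := {t | (∀ i, t i ∈ altTwo k d) ∧ ∀ i j l, t i j l = t j l i}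
  add_mem' := by
    rintro s t ⟨h1, h2⟩ ⟨h3, h4⟩
    refine ⟨fun i => add_mem (h1 i) (h3 i), fun i j l => ?_⟩
    simp only [Pi.add_apply]
    rw [h2 i j, h4 i j]
  zero_mem' := ⟨fun _ => zero_mem _, fun _ _ _ => rfl⟩
  smul_mem' := by
    rintro c s ⟨h1, h2⟩
    refine ⟨fun i => Submodule.smul_mem _ _ (h1 i), fun i j l => ?_⟩
    simp only [Pi.smul_apply]
    rw [h2 i j]

theorem finrank_altTwo_le (d : ℕ) : finrank k (altTwo k d) ≤ d * (d - 1) / 2 := by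
  rw [← card_subtype_fst_lt_snd, ← Module.finrank_fintype_fun_eq_card k]
  let r : altTwo k d →ₗ[k] ({p : Fin d × Fin d // p.1 < p.2} → k) :=
    { toFun := fun s p => s.1 p.1.1 p.1.2
      map_add' := fun _ _ => rfl
      map_smul' := fun _ _ => rfl }
  refine LinearMap.finrank_le_finrank_of_injective (f := r) ?_
  rw [injective_iff_map_eq_zero]
  rintro ⟨s, hs1, hs2⟩ h
  have key : ∀ i j, i < j → s i j = 0 := fun i j hij => congrFun h ⟨(i, j), hij⟩
  ext i j
  rcases lt_trichotomy i j with hij | rfl | hij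
  · exact key i j hij
  · exact hs1 i
  · simpa [key j i hij] using hs2 i j

/-- A trivector all of whose contractions lie in a space of bivectors of dimension at most three
is determined, up to a scalar, by that space. -/
theorem altThree_proportional {d : ℕ} {S : Submodule k (Fin d → Fin d → k)}
    (hS : finrank k S ≤ 3) {t t' : Fin d → Fin d → Fin d → k}
    (ht : t ∈ altThree k d) (ht' : t' ∈ altThree k d) (hc : ∀ i, t i ∈ S) (hc' : ∀ i, t' i ∈ S)
    (a b c : Fin d) (h : t a b c ≠ 0) : t a b c • t' = t' a b c • t := by
  let ev : S →ₗ[k] (Fin 3 → k) :=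
    { toFun := fun s => ![s.1 b c, s.1 c a, s.1 a b]
      map_add' := fun _ _ => by ext i; fin_cases i <;> rfl
      map_smul' := fun _ _ => by ext i; fin_cases i <;> rfl }
  have e1 : ∀ i j, t i j i = 0 := fun i j => by rw [ht.2, (ht.1 _).1]
  have e2 : ∀ i j, t i i j = 0 := fun i j => by rw [ht.2, e1]
  have hsurj : Function.Surjective ev := by
    intro v
    refine ⟨(t a b c)⁻¹ • (v 0 • ⟨t a, hc a⟩ + v 1 • ⟨t b, hc b⟩ + v 2 • ⟨t c, hc c⟩), ?_⟩
    have h2 : t b c a = t a b c := (ht.2 a b c).symm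
    have h3 : t c a b = t a b c := ht.2 c a b
    ext i
    fin_cases i <;> simp [ev, e1, e2, h2, h3] <;> field_simp
  have hinj : Function.Injective ev := by
    have h3 : finrank k S = finrank k (Fin 3 → k) :=
      le_antisymm (by simpa using hS) (LinearMap.finrank_le_finrank_of_surjective hsurj)
    exact (LinearMap.injective_iff_surjective_of_finrank_eq_finrank h3).2 hsurj
  have hzero : ∀ s ∈ S, s b c = 0 → s c a = 0 → s a b = 0 → s = 0 := by
    intro s hs h1 h2 h3
    have : (⟨s, hs⟩ : S) = 0 := hinj (by
      rw [map_zero]; ext i; fin_cases i <;> simp [ev, h1, h2, h3])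
    exact congrArg Subtype.val this
  rw [← sub_eq_zero]
  set u := t a b c • t' - t' a b c • t with hu
  have hu3 : u ∈ altThree k d :=
    sub_mem (Submodule.smul_mem _ _ ht') (Submodule.smul_mem _ _ ht)
  have huS : ∀ i, u i ∈ S := fun i =>
    sub_mem (Submodule.smul_mem _ _ (hc' i)) (Submodule.smul_mem _ _ (hc i))
  have f1 : ∀ i j, u i j i = 0 := fun i j => by rw [hu3.2, (hu3.1 _).1]
  have f2 : ∀ i j, u i i j = 0 := fun i j => by rw [hu3.2, f1]
  have habc : u a b c = 0 := by simp [hu, mul_comm]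
  have hbca : u b c a = 0 := by rw [← hu3.2, habc]
  have hcab : u c a b = 0 := by rw [hu3.2, habc]
  have ha : u a = 0 := hzero _ (huS a) habc (f1 _ _) (f2 _ _)
  have hb : u b = 0 := hzero _ (huS b) (f2 _ _) hbca (f1 _ _)
  have hc0 : u c = 0 := hzero _ (huS c) (f1 _ _) (f2 _ _) hcab
  funext i
  refine hzero _ (huS i) ?_ ?_ ?_
  · rw [hu3.2, hb]; rfl
  · rw [hu3.2, hc0]; rfl
  · rw [hu3.2, ha]; rfl

variable {W : Type*} [AddCommGroup W] [Module k W]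

/-- The linear map sending a bivector with coordinates `s` to `∑_{i<j} s i j • B i j`. -/
def bivectorMap {d : ℕ} (B : Fin d → Fin d → W) : (Fin d → Fin d → k) →ₗ[k] W where
  toFun s := ∑ i, ∑ j, if i < j then s i j • B i j else 0
  map_add' s t := by
    simp only [← Finset.sum_add_distrib]
    refine Finset.sum_congr rfl fun i _ => Finset.sum_congr rfl fun j _ => ?_
    split_ifs <;> simp [add_smul]
  map_smul' c s := by
    simp only [Finset.smul_sum]
    refine Finset.sum_congr rfl fun i _ => Finset.sum_congr rfl fun j _ => ?_
    split_ifs <;> simp [mul_smul]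

/-- The coordinates of the bivector `e_a ∧ e_b`. -/
def wedge (k : Type u) [Field k] {d : ℕ} (a b : Fin d) : Fin d → Fin d → k :=
  fun i j => (if i = a then 1 else 0) * (if j = b then 1 else 0)
    - (if i = b then 1 else 0) * (if j = a then 1 else 0)

theorem wedge_mem_altTwo {d : ℕ} (a b : Fin d) : wedge k a b ∈ altTwo k d :=
  ⟨fun _ => by simp only [wedge]; ring, fun _ _ => by simp only [wedge]; ring⟩

theorem bivectorMap_wedge {d : ℕ} {B : Fin d → Fin d → W} (h0 : ∀ i, B i i = 0)
    (h1 : ∀ i j, B i j = -B j i) (a b : Fin d) : bivectorMap B (wedge k a b) = B a b := by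
  have : ∀ i j, (if i < j then wedge k a b i j • B i j else 0) =
      (if i = a then (if j = b then (if a < b then B a b else 0) else 0) else 0)
      + (if i = b then (if j = a then (if b < a then -B b a else 0) else 0) else 0) := by
    intro i j
    clear h0 h1
    by_cases hia : i = a <;> by_cases hib : i = b <;> by_cases hja : j = a <;>
      by_cases hjb : j = b <;> simp_all [wedge]
  simp only [bivectorMap, LinearMap.coe_mk, AddHom.coe_mk, this, Finset.sum_add_distrib]
  simp only [Finset.sum_ite_irrel, Finset.sum_ite_eq', Finset.mem_univ, if_true,
    Finset.sum_const_zero]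
  rcases lt_trichotomy a b with h | rfl | h
  · simp [h, h.not_gt]
  · simp [h0]
  · simp [h, h.not_gt, h1 a b]

theorem exists_cocycle_coordinates [FiniteDimensional k W] {d : ℕ} (hd : 2 ≤ d)
    {B : Fin d → Fin d → W} (h0 : ∀ i, B i i = 0) (h1 : ∀ i j, B i j = -B j i)
    (hspan : Submodule.span k (Set.range fun p : Fin d × Fin d => B p.1 p.2) = ⊤)
    (hdim : d * (d - 1) / 2 ≤ finrank k W + 2) {x : W} (hx : x ≠ 0) :
    ∃ g : Fin d → W →ₗ[k] k,
      (∀ a b c, g c (B a b) + g a (B b c) + g b (B c a) = 0) ∧ ∃ i, g i x ≠ 0 := by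
  let π : (Fin d → Fin d → k) →ₗ[k] W := bivectorMap B
  have hπ : ∀ a b, π (wedge k a b) = B a b := bivectorMap_wedge h0 h1
  let q : altTwo k d →ₗ[k] (W ⧸ Submodule.span k {x}) :=
    (Submodule.mkQ _ ∘ₗ π).domRestrict (altTwo k d)
  have hq : Function.Surjective q := by
    have : Function.Surjective (π.domRestrict (altTwo k d)) := by
      rw [← LinearMap.range_eq_top, eq_top_iff, ← hspan, Submodule.span_le]
      rintro _ ⟨p, rfl⟩
      exact ⟨⟨wedge k p.1 p.2, wedge_mem_altTwo _ _⟩, hπ _ _⟩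
    exact (Submodule.mkQ_surjective _).comp this
  let S : Submodule k (Fin d → Fin d → k) := q.ker.map (altTwo k d).subtype
  have hmem : ∀ s ∈ altTwo k d, π s ∈ Submodule.span k {x} → s ∈ S := by
    intro s hs h
    exact ⟨⟨s, hs⟩, (Submodule.Quotient.mk_eq_zero _).2 h, rfl⟩
  have hS : finrank k S ≤ 3 := by
    have e1 : finrank k S = finrank k q.ker :=
      Submodule.finrank_map_subtype_eq _ _
    have e2 := q.finrank_range_add_finrank_ker
    rw [LinearMap.range_eq_top.2 hq, finrank_top] at e2
    have e3 := Submodule.finrank_quotient_add_finrank (Submodule.span k {x})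
    rw [finrank_span_singleton hx] at e3
    have e4 := finrank_altTwo_le (k := k) d
    omega
  let τ : altThree k d →ₗ[k] (Fin d → W) :=
    LinearMap.pi fun c => π ∘ₗ LinearMap.proj c ∘ₗ (altThree k d).subtype
  have hτ : ∃ i, (Pi.single i x : Fin d → W) ∉ LinearMap.range τ := by
    by_contra! hall
    let i₀ : Fin d := ⟨0, by omega⟩
    let i₁ : Fin d := ⟨1, by omega⟩
    have hne : i₀ ≠ i₁ := by simp [i₀, i₁]
    obtain ⟨⟨t, ht⟩, e⟩ := hall i₀
    obtain ⟨⟨t', ht'⟩, e'⟩ := hall i₁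
    have ec : ∀ c, π (t c) = (Pi.single i₀ x : Fin d → W) c := fun c => congrFun e c
    have ec' : ∀ c, π (t' c) = (Pi.single i₁ x : Fin d → W) c := fun c => congrFun e' c
    have aux : ∀ i c, (Pi.single i x : Fin d → W) c ∈ Submodule.span k {x} := by
      intro i c
      by_cases h : c = i
      · subst h; simp [Submodule.mem_span_singleton_self]
      · simp [h]
    have hcS : ∀ i, t i ∈ S := fun i => hmem _ (ht.1 i) (ec i ▸ aux _ _)
    have hcS' : ∀ i, t' i ∈ S := fun i => hmem _ (ht'.1 i) (ec' i ▸ aux _ _)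
    have : ∃ a b c, t a b c ≠ 0 := by
      by_contra! hz
      have : t i₀ = 0 := by ext b c; exact hz _ _ _
      have h2 := ec i₀
      rw [this, map_zero, Pi.single_eq_same] at h2
      exact hx h2.symm
    obtain ⟨a, b, c, habc⟩ := this
    have hp : t a b c • π (t' i₁) = t' a b c • π (t i₁) := by
      rw [← map_smul, ← map_smul]
      exact congrArg π (congrFun (altThree_proportional hS ht ht' hcS hcS' a b c habc) i₁)
    rw [ec, ec', Pi.single_eq_same, Pi.single_eq_of_ne hne.symm, smul_zero, smul_eq_zero] at hp
    exact hp.elim habc hx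
  obtain ⟨i, hi⟩ := hτ
  obtain ⟨ψ, hψ1, hψ2⟩ := Submodule.exists_le_ker_of_notMem hi
  refine ⟨fun c => ψ ∘ₗ LinearMap.single k (fun _ => W) c, fun a b c => ?_, i, hψ1⟩
  let t : Fin d → Fin d → Fin d → k := fun l =>
    (if l = c then (1 : k) else 0) • wedge k a b + (if l = a then (1 : k) else 0) • wedge k b c
      + (if l = b then (1 : k) else 0) • wedge k c a
  have ht : t ∈ altThree k d := by
    refine ⟨fun l => ?_, fun l m n => ?_⟩
    · exact add_mem (add_mem (Submodule.smul_mem _ _ (wedge_mem_altTwo _ _))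
        (Submodule.smul_mem _ _ (wedge_mem_altTwo _ _)))
        (Submodule.smul_mem _ _ (wedge_mem_altTwo _ _))
    · simp only [t, wedge, Pi.add_apply, Pi.smul_apply, smul_eq_mul]
      ring
  have hker : ψ (τ ⟨t, ht⟩) = 0 := hψ2 ⟨_, rfl⟩
  have : τ ⟨t, ht⟩ = Pi.single c (B a b) + Pi.single a (B b c) + Pi.single b (B c a) := by
    funext l
    change π (t l) = _
    simp only [t, map_add, map_smul, hπ, Pi.add_apply, Pi.single_apply]
    simp only [ite_smul, one_smul, zero_smul]
  rw [this, map_add, map_add] at hker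
  exact hker

end Core

section Extension
variable {k} {L : Type v} [LieRing L] [LieAlgebra k L]

/-- The 2-cocycle condition for a bilinear map with values in a trivial module. -/
structure IsTrivialCocycle {M : Type*} [AddCommGroup M] [Module k M] (f : L →ₗ[k] L →ₗ[k] M) :
    Prop where
  self : ∀ a, f a a = 0
  jacobi : ∀ a b c, f ⁅a, b⁆ c + f ⁅b, c⁆ a + f ⁅c, a⁆ b = 0

theorem IsTrivialCocycle.skew {M : Type*} [AddCommGroup M] [Module k M] {f : L →ₗ[k] L →ₗ[k] M}
    (hf : IsTrivialCocycle f) (a b : L) : f a b = -f b a := by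
  have := hf.self (a + b)
  simp only [map_add, LinearMap.add_apply, hf.self, zero_add, add_zero] at this
  exact eq_neg_of_add_eq_zero_right this

/-- The central extension of `L` by `M` defined by a 2-cocycle with values in the trivial module
`M`, as a type synonym of `L × M`. -/
def CentralExtension {M : Type*} [AddCommGroup M] [Module k M] {f : L →ₗ[k] L →ₗ[k] M}
    (_ : IsTrivialCocycle f) : Type _ := L × M

namespace CentralExtension

variable {M : Type*} [AddCommGroup M] [Module k M] {f : L →ₗ[k] L →ₗ[k] M}
  (hf : IsTrivialCocycle f)

instance : AddCommGroup (CentralExtension hf) := inferInstanceAs (AddCommGroup (L × M))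

instance : Module k (CentralExtension hf) := inferInstanceAs (Module k (L × M))

instance : LieRing (CentralExtension hf) where
  bracket x y := ((⁅x.1, y.1⁆, f x.1 y.1) : L × M)
  add_lie x y z := by
    change ((⁅x.1 + y.1, z.1⁆, f (x.1 + y.1) z.1) : L × M) = (⁅x.1, z.1⁆ + ⁅y.1, z.1⁆, _ + _)
    simp
  lie_add x y z := by
    change ((⁅x.1, y.1 + z.1⁆, f x.1 (y.1 + z.1)) : L × M) = (⁅x.1, y.1⁆ + ⁅x.1, z.1⁆, _ + _)
    simp
  lie_self x := by
    change ((⁅x.1, x.1⁆, f x.1 x.1) : L × M) = 0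
    simp [hf.self]
  leibniz_lie x y z := by
    change ((⁅x.1, ⁅y.1, z.1⁆⁆, f x.1 ⁅y.1, z.1⁆) : L × M) =
      (⁅⁅x.1, y.1⁆, z.1⁆ + ⁅y.1, ⁅x.1, z.1⁆⁆, f ⁅x.1, y.1⁆ z.1 + f y.1 ⁅x.1, z.1⁆)
    refine Prod.ext (leibniz_lie _ _ _) ?_
    change f x.1 ⁅y.1, z.1⁆ = f ⁅x.1, y.1⁆ z.1 + f y.1 ⁅x.1, z.1⁆
    rw [hf.skew x.1, hf.skew y.1, ← lie_skew x.1 z.1, map_neg, LinearMap.neg_apply, neg_neg,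
      neg_eq_iff_add_eq_zero, ← hf.jacobi x.1 y.1 z.1]
    abel

theorem lie_def (x y : CentralExtension hf) :
    ⁅x, y⁆ = ((⁅x.1, y.1⁆, f x.1 y.1) : L × M) := rfl

instance : LieAlgebra k (CentralExtension hf) where
  lie_smul c x y := by
    change ((⁅x.1, c • y.1⁆, f x.1 (c • y.1)) : L × M) = (c • ⁅x.1, y.1⁆, c • f x.1 y.1)
    simp

/-- The projection of a central extension onto the base. -/
def proj : CentralExtension hf →ₗ⁅k⁆ L :=
  { LinearMap.fst k L M with map_lie' := rfl }

theorem proj_surjective : Function.Surjective (proj hf) := fun x => ⟨(x, 0), rfl⟩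

theorem center_eq_ker_proj (h : ∀ x ∈ LieAlgebra.center k L, (∀ y, f x y = 0) → x = 0) :
    LieAlgebra.center k (CentralExtension hf) = (proj hf).ker := by
  ext x
  rw [LieModule.mem_maxTrivSubmodule, LieHom.mem_ker]
  constructor
  · intro hx
    have hx' : ∀ y : L, ⁅y, x.1⁆ = 0 ∧ f y x.1 = 0 := fun y =>
      Prod.mk_eq_zero.1 (hx ((y, 0) : L × M))
    refine h x.1 (fun y => (hx' y).1) fun y => ?_
    rw [hf.skew, (hx' y).2, neg_zero]
  · intro hx y
    have hx : x.1 = 0 := hx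
    rw [lie_def, hx, lie_zero, map_zero]
    rfl

end CentralExtension

/-- A Lie algebra is capable as soon as no nonzero central element lies in the radical of all
scalar 2-cocycles. -/
theorem nonempty_capableWitness_of_cocycles
    (h : ∀ x ∈ LieAlgebra.center k L, x ≠ 0 →
      ∃ f : L →ₗ[k] L →ₗ[k] k, IsTrivialCocycle f ∧ ∃ y, f x y ≠ 0) :
    Nonempty (CapableWitness k L) := by
  let F : L →ₗ[k] L →ₗ[k] ({f : L →ₗ[k] L →ₗ[k] L // IsTrivialCocycle f} → L) :=
    LinearMap.mk₂ k (fun a b f => f.1 a b) (fun _ _ _ => by ext; simp) (fun _ _ _ => by ext; simp)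
      (fun _ _ _ => by ext; simp) (fun _ _ _ => by ext; simp)
  have hF : IsTrivialCocycle F :=
    ⟨fun a => funext fun f => f.2.self a, fun a b c => funext fun f => f.2.jacobi a b c⟩
  have hcenter := CentralExtension.center_eq_ker_proj hF (by
    intro x hx hxy
    by_contra hx0
    obtain ⟨f, hf, y, hy⟩ := h x hx hx0
    let f' : L →ₗ[k] L →ₗ[k] L := f.compr₂ (LinearMap.toSpanSingleton k L x)
    have hf' : IsTrivialCocycle f' :=
      ⟨fun a => by simp [f', hf.self], fun a b c => by
        simp only [f', LinearMap.compr₂_apply, ← map_add, hf.jacobi, map_zero]⟩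
    have : f x y • x = 0 := congrFun (hxy y) ⟨f', hf'⟩
    exact (smul_ne_zero hy hx0) this)
  suffices e : (CentralExtension hF ⧸ LieAlgebra.center k (CentralExtension hF)) ≃ₗ⁅k⁆ L from
    ⟨{ E := CentralExtension hF, equiv := e }⟩
  rw [hcenter]
  exact (CentralExtension.proj hF).quotKerEquivRange.trans
    ((LieEquiv.ofEq _ _ (congrArg SetLike.coe
      ((LieHom.range_eq_top _).2 (CentralExtension.proj_surjective hF)))).trans
      LieSubalgebra.topEquiv)

end Extension

section ClassTwo
variable {k} {L : Type v} [LieRing L] [LieAlgebra k L]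

theorem lie_mem_lieSq (a b : L) : ⁅a, b⁆ ∈ lieSq k L := by
  rw [lieSq, LieModule.lowerCentralSeries_succ]
  exact LieSubmodule.lie_mem_lie (LieSubmodule.mem_top _) (LieSubmodule.mem_top _)

theorem lieSq_le {p : Submodule k L} (h : ∀ a b : L, ⁅a, b⁆ ∈ p) : lieSq k L ≤ p := by
  rw [lieSq, LieModule.lowerCentralSeries_succ, LieSubmodule.lieIdeal_oper_eq_linear_span',
    Submodule.span_le]
  rintro _ ⟨a, -, b, -, rfl⟩
  exact h a b

theorem lie_mem_lieCtr (h : LieModule.lowerCentralSeries k L L 2 = ⊥) (a b : L) :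
    ⁅a, b⁆ ∈ lieCtr k L := by
  intro c
  rw [← LieSubmodule.mem_bot (R := k) (L := L), ← h, LieModule.lowerCentralSeries_succ]
  exact LieSubmodule.lie_mem_lie (LieSubmodule.mem_top _) (lie_mem_lieSq a b)

theorem exists_cocycle_of_notMem_lieSq (hcl2 : LieModule.lowerCentralSeries k L L 2 = ⊥)
    (hZ : lieCtr k L ≠ ⊤) {x : L} (hx : x ∈ LieAlgebra.center k L) (hxs : x ∉ lieSq k L) :
    ∃ f : L →ₗ[k] L →ₗ[k] k, IsTrivialCocycle f ∧ ∃ y, f x y ≠ 0 := by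
  obtain ⟨φ, hφx, hφ⟩ := Submodule.exists_le_ker_of_notMem hxs
  obtain ⟨ψ, hψ0, hψ⟩ := Submodule.exists_le_ker_of_lt_top _ hZ.lt_top
  obtain ⟨y, hy⟩ : ∃ y, ψ y ≠ 0 := by
    by_contra! h
    exact hψ0 (LinearMap.ext h)
  have hφl : ∀ a b : L, φ ⁅a, b⁆ = 0 := fun a b => hφ (lie_mem_lieSq a b)
  have hψl : ∀ a b : L, ψ ⁅a, b⁆ = 0 := fun a b => hψ (lie_mem_lieCtr hcl2 a b)
  have hψx : ψ x = 0 := hψ hx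
  refine ⟨LinearMap.mk₂ k (fun a b => φ a * ψ b - φ b * ψ a) ?_ ?_ ?_ ?_, ⟨?_, ?_⟩, y, ?_⟩
  · intros; simp only [map_add]; ring
  · intros; simp only [map_smul, smul_eq_mul]; ring
  · intros; simp only [map_add]; ring
  · intros; simp only [map_smul, smul_eq_mul]; ring
  · intro a; simp
  · intro a b c; simp [hφl, hψl]
  · simp [hψx, hφx, hy]

theorem exists_cocycle_of_mem_lieSq [FiniteDimensional k L]
    (hcl2 : LieModule.lowerCentralSeries k L L 2 = ⊥) {d : ℕ} (hd : 2 ≤ d)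
    (hZ : finrank k (L ⧸ lieCtr k L) = d) (hdim : d * (d - 1) / 2 ≤ finrank k (lieSq k L) + 2)
    {x : L} (hx0 : x ≠ 0) (hxs : x ∈ lieSq k L) :
    ∃ f : L →ₗ[k] L →ₗ[k] k, IsTrivialCocycle f ∧ ∃ y, f x y ≠ 0 := by
  let v : Basis (Fin d) k (L ⧸ lieCtr k L) := finBasisOfFinrankEq k _ hZ
  choose e he using fun i => (lieCtr k L).mkQ_surjective (v i)
  let X : Fin d → L →ₗ[k] k := fun i => v.coord i ∘ₗ (lieCtr k L).mkQ
  have hXZ : ∀ z ∈ lieCtr k L, ∀ i, X i z = 0 := fun z hz i => by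
    have : (lieCtr k L).mkQ z = 0 := (Submodule.Quotient.mk_eq_zero _).2 hz
    simp only [X, LinearMap.comp_apply, this, map_zero]
  have hXe : ∀ i, X i (e i) = 1 := fun i => by
    simp [X, he]
  have hdecomp : ∀ a, a - ∑ i, X i a • e i ∈ lieCtr k L := fun a => by
    rw [← Submodule.ker_mkQ (lieCtr k L), LinearMap.mem_ker, map_sub, map_sum, sub_eq_zero]
    simp only [map_smul, he]
    exact (v.sum_repr _).symm
  have hlie : ∀ a b : L, ⁅a, b⁆ = ∑ i, ∑ j, (X i a * X j b) • ⁅e i, e j⁆ := by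
    intro a b
    have h1 : ⁅a, b⁆ = ⁅a, ∑ j, X j b • e j⁆ := by
      rw [← sub_eq_zero, ← lie_sub]
      exact hdecomp b a
    have h2 : ∀ c : L, ⁅a, c⁆ = ⁅∑ j, X j a • e j, c⁆ := fun c => by
      rw [← sub_eq_zero, ← sub_lie, ← lie_skew, neg_eq_zero]
      exact hdecomp a c
    rw [h1, h2, sum_lie]
    refine Finset.sum_congr rfl fun i _ => ?_
    rw [lie_sum]
    refine Finset.sum_congr rfl fun j _ => ?_
    rw [smul_lie, lie_smul, smul_smul]
  let B : Fin d → Fin d → lieSq k L := fun i j => ⟨⁅e i, e j⁆, lie_mem_lieSq _ _⟩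
  have hspan : Submodule.span k (Set.range fun p : Fin d × Fin d => B p.1 p.2) = ⊤ := by
    rw [eq_top_iff]
    rintro ⟨w, hw⟩ -
    have hle : lieSq k L ≤ (Submodule.span k
        (Set.range fun p : Fin d × Fin d => B p.1 p.2)).map (lieSq k L).subtype := by
      refine lieSq_le fun a b => ?_
      rw [hlie]
      exact Submodule.sum_mem _ fun i _ => Submodule.sum_mem _ fun j _ => Submodule.smul_mem _ _
        ⟨B i j, Submodule.subset_span ⟨(i, j), rfl⟩, rfl⟩
    obtain ⟨w', hw', h⟩ := hle hw
    rwa [← show w' = ⟨w, hw⟩ from Subtype.ext h]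
  obtain ⟨g, hg, i, hi⟩ := exists_cocycle_coordinates hd (B := B)
    (fun i => Subtype.ext (lie_self _)) (fun i j => Subtype.ext (lie_skew _ _).symm) hspan hdim
    (x := ⟨x, hxs⟩) (fun h => hx0 (congrArg Subtype.val h))
  obtain ⟨ρ, hρ⟩ := (lieSq k L).subtype.exists_leftInverse_of_injective
    (Submodule.ker_subtype _)
  have hρ' : ∀ w : lieSq k L, ρ w = w := fun w => LinearMap.congr_fun hρ w
  have hρl : ∀ a b : L, ρ ⁅a, b⁆ = ∑ i, ∑ j, (X i a * X j b) • B i j := fun a b => by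
    rw [hlie]
    simp only [map_sum, map_smul]
    exact Finset.sum_congr rfl fun i _ => Finset.sum_congr rfl fun j _ => by rw [← hρ' (B i j)]
  have hXl : ∀ i a b, X i ⁅a, b⁆ = 0 := fun i a b => hXZ _ (lie_mem_lieCtr hcl2 a b) i
  have hXx : ∀ i, X i x = 0 := hXZ x (lieSq_le (lie_mem_lieCtr hcl2) hxs)
  have rot : ∀ F : Fin d → Fin d → Fin d → k,
      ∑ p, ∑ q, ∑ r, F p q r = ∑ q, ∑ r, ∑ p, F p q r := fun F => by
    rw [Finset.sum_comm]
    exact Finset.sum_congr rfl fun _ _ => Finset.sum_comm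
  refine ⟨LinearMap.mk₂ k (fun a b => ∑ i, (g i (ρ a) * X i b - g i (ρ b) * X i a)) ?_ ?_ ?_ ?_,
    ⟨?_, ?_⟩, e i, ?_⟩
  · intros
    rw [← Finset.sum_add_distrib]
    refine Finset.sum_congr rfl fun _ _ => ?_
    simp only [map_add]; ring
  · intros
    rw [Finset.smul_sum]
    refine Finset.sum_congr rfl fun _ _ => ?_
    simp only [map_smul, smul_eq_mul]; ring
  · intros
    rw [← Finset.sum_add_distrib]
    refine Finset.sum_congr rfl fun _ _ => ?_
    simp only [map_add]; ring
  · intros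
    rw [Finset.smul_sum]
    refine Finset.sum_congr rfl fun _ _ => ?_
    simp only [map_smul, smul_eq_mul]; ring
  · intro a; simp
  · intro a b c
    have key : ∀ a b c, ∑ i, (g i (ρ ⁅a, b⁆) * X i c - g i (ρ c) * X i ⁅a, b⁆) =
        ∑ i, ∑ p, ∑ q, X p a * X q b * X i c * g i (B p q) := by
      intro a b c
      refine Finset.sum_congr rfl fun i _ => ?_
      rw [hXl, mul_zero, sub_zero, hρl]
      simp only [map_sum, map_smul, smul_eq_mul, Finset.sum_mul]
      refine Finset.sum_congr rfl fun _ _ => Finset.sum_congr rfl fun _ _ => ?_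
      ring
    simp only [LinearMap.mk₂_apply, key]
    rw [rot, rot fun i p q => X p c * X q a * X i b * g i (B p q),
      rot fun p q i => X p c * X q a * X i b * g i (B p q)]
    simp only [← Finset.sum_add_distrib]
    refine Finset.sum_eq_zero fun p _ => Finset.sum_eq_zero fun q _ =>
      Finset.sum_eq_zero fun r _ => ?_
    linear_combination X p a * X q b * X r c * hg p q r
  · have hρx : ρ x = ⟨x, hxs⟩ := hρ' ⟨x, hxs⟩
    rw [LinearMap.mk₂_apply, Finset.sum_eq_single i]
    · simpa [hρx, hXx, hXe] using hi
    · intro j _ hj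
      simp [hXx, X, he, hj.symm]
    · simp

end ClassTwo

/-- A finite-dimensional Lie algebra of nilpotency class two with `dim(L/Z(L)) = d ≥ 3` and
`dim L² = ½d(d−1) − 1` or `dim L² = ½d(d−1) − 2` is capable. -/
theorem stmt12 (L : Type v) [LieRing L] [LieAlgebra k L] [FiniteDimensional k L]
    (hcl2 : LieModule.lowerCentralSeries k L L 2 = ⊥)
    (hcl1 : LieModule.lowerCentralSeries k L L 1 ≠ ⊥)
    (d : ℕ) (hd3 : 3 ≤ d)
    (hZ : finrank k (L ⧸ lieCtr k L) = d)
    (hrk : finrank k (lieSq k L) = d * (d - 1) / 2 - 1 ∨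
      finrank k (lieSq k L) = d * (d - 1) / 2 - 2) :
    Nonempty (CapableWitness k L) := by
  have hdim : d * (d - 1) / 2 ≤ finrank k (lieSq k L) + 2 := by omega
  refine nonempty_capableWitness_of_cocycles fun x hx hx0 => ?_
  by_cases hxs : x ∈ lieSq k L
  · exact exists_cocycle_of_mem_lieSq hcl2 (by omega) hZ hdim hx0 hxs
  · refine exists_cocycle_of_notMem_lieSq hcl2 (fun h => ?_) hx hxs
    have : Subsingleton (L ⧸ lieCtr k L) := Submodule.Quotient.subsingleton_iff.2 h
    have := finrank_zero_of_subsingleton (R := k) (M := L ⧸ lieCtr k L)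
    omega
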